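/- Let Q : (0,∞) → M_d(ℝ) be a matrix-valued complete Bernstein function with real symmetric values, let G∞ be a real symmetric positive definite matrix with Q(x) ≥ G∞ (in the Loewner order) for all x > 0, and suppose the analytic continuation Q(z) has no eigenvalue in (−∞,0] for every z ∈ ℂ ∖ (−∞,0]. Then for every ρ > 0 the function K(p) := ρ·p·Q(p)^{-1/2}, where Q(p)^{-1/2} denotes the inverse of the principal square root of Q(p), is a matrix-valued complete Bernstein function. -/

import Mathlib

open MeasureTheory Complex Filter
open scoped ComplexOrder Matrix

noncomputable section

/-- The "imaginary part" `(X - Xᴴ)/(2i)` of a complex square matrix. -/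
def Matrix.imP {d : ℕ} (X : Matrix (Fin d) (Fin d) ℂ) : Matrix (Fin d) (Fin d) ℂ :=
  (2 * Complex.I)⁻¹ • (X - Xᴴ)

/-- `F` witnesses that `A : (0,∞) → M_d(ℝ)` is a matrix-valued complete Bernstein function:
`F` is an analytic continuation of `A` to the cut plane `ℂ ∖ (−∞,0]` satisfying
`(Im z)·Im F(z) ≥ 0` there, and `A` has a (real) limit at `0+`. -/
def IsMvCBFWith {d : ℕ} (A : ℝ → Matrix (Fin d) (Fin d) ℝ)
    (F : ℂ → Matrix (Fin d) (Fin d) ℂ) : Prop :=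
  (∀ i j, DifferentiableOn ℂ (fun z => F z i j) Complex.slitPlane) ∧
  (∀ x : ℝ, 0 < x → F (x : ℂ) = (A x).map (fun t => (t : ℂ))) ∧
  (∀ z ∈ Complex.slitPlane, (((z.im : ℂ)) • (F z).imP).PosSemidef) ∧
  (∃ L : Matrix (Fin d) (Fin d) ℝ, Tendsto A (nhdsWithin 0 (Set.Ioi 0)) (nhds L))

/-- `A : (0,∞) → M_d(ℝ)` is a matrix-valued complete Bernstein function. -/
def IsMvCBF {d : ℕ} (A : ℝ → Matrix (Fin d) (Fin d) ℝ) : Prop :=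
  ∃ F : ℂ → Matrix (Fin d) (Fin d) ℂ, IsMvCBFWith A F

open scoped ComplexConjugate Topology

/-- A holomorphic self-map of the upper half-plane that is positive on the positive axis does not
increase the argument. -/
lemma arg_apply_le_arg (f : ℂ → ℂ) (hf : DifferentiableOn ℂ f slitPlane)
    (him : ∀ z : ℂ, 0 < z.im → 0 < (f z).im)
    (hpos : ∀ x : ℝ, 0 < x → (f x).im = 0 ∧ 0 < (f x).re)
    {z : ℂ} (hz : 0 < z.im) : (f z).arg ≤ z.arg := by
  have hz0 : z ≠ 0 := by rintro rfl; simp at hz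
  have hzpi : z.arg < Real.pi := by
    rw [arg_lt_pi_iff]; exact Or.inr hz.ne'
  have hznn : 0 ≤ z.arg := arg_nonneg_iff.2 hz.le
  refine le_of_forall_pos_le_add fun ε hε => ?_
  set b : ℝ := Real.pi - min ε (Real.pi - z.arg) with hb
  have hmpos : 0 < min ε (Real.pi - z.arg) := lt_min hε (by linarith)
  have hbpi : b < Real.pi := by linarith
  have hzb : z.arg ≤ b := by linarith [min_le_right ε (Real.pi - z.arg)]
  have hbε : Real.pi - b ≤ ε := by linarith [min_le_left ε (Real.pi - z.arg)]
  have hstrip : ∀ w : ℂ, 0 ≤ w.im → w.im ≤ b →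
      exp w ∈ slitPlane ∧ f (exp w) ∈ slitPlane ∧ 0 ≤ (f (exp w)).im ∧
        (w.im = 0 → (f (exp w)).arg = 0) := by
    intro w h0 h1
    rcases h0.eq_or_lt with h0 | h0
    · have hw : exp w = ((Real.exp w.re : ℝ) : ℂ) := by
        rw [ofReal_exp]; congr 1; apply Complex.ext <;> simp [← h0]
      obtain ⟨h3, h4⟩ := hpos _ (Real.exp_pos w.re)
      rw [hw]
      exact ⟨ofReal_mem_slitPlane.2 (Real.exp_pos _), Or.inl h4, h3.ge,
        fun _ => arg_eq_zero_iff.2 ⟨h4.le, h3⟩⟩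
    · have hwim : 0 < (exp w).im := by
        rw [exp_im]
        exact mul_pos (Real.exp_pos _) (Real.sin_pos_of_pos_of_lt_pi h0 (by linarith))
      have := him _ hwim
      exact ⟨Or.inr hwim.ne', Or.inr this.ne', this.le, fun h => absurd h h0.ne'⟩
  have hnorm : ∀ w : ℂ, ‖exp (-I * (log (f (exp w)) - w))‖
      = Real.exp ((f (exp w)).arg - w.im) := by
    intro w; rw [norm_exp]; simp [log_im]
  have hbd : ∀ w : ℂ, 0 ≤ w.im → w.im ≤ b →
      ‖exp (-I * (log (f (exp w)) - w))‖ ≤ Real.exp Real.pi := by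
    intro w h0 _
    rw [hnorm, Real.exp_le_exp]
    linarith [arg_le_pi (f (exp w))]
  have hdiff : ∀ w : ℂ, 0 ≤ w.im → w.im ≤ b →
      DifferentiableAt ℂ (fun w => exp (-I * (log (f (exp w)) - w))) w := by
    intro w h0 h1
    obtain ⟨h2, h3, -, -⟩ := hstrip w h0 h1
    have h4 : DifferentiableAt ℂ (fun w => f (exp w)) w :=
      (hf.differentiableAt (isOpen_slitPlane.mem_nhds h2)).comp w differentiableAt_exp
    exact (((h4.clog h3).sub differentiableAt_id).const_mul _).cexp
  have key := PhragmenLindelof.horizontal_strip (a := 0) (b := b) (C := Real.exp ε)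
    (f := fun w => exp (-I * (log (f (exp w)) - w))) (z := log z) ?_ ?_ ?_ ?_
    (by simpa [log_im] using hznn) (by simpa [log_im] using hzb)
  · rw [hnorm, exp_log hz0, Real.exp_le_exp, log_im] at key
    linarith
  · apply DifferentiableOn.diffContOnCl
    intro w hw
    have hcl : IsClosed (im ⁻¹' Set.Icc 0 b) := isClosed_Icc.preimage continuous_im
    have := closure_minimal (Set.preimage_mono Set.Ioo_subset_Icc_self) hcl hw
    exact (hdiff w this.1 this.2).differentiableWithinAt
  · refine ⟨0, div_pos Real.pi_pos (by
      have : 0 < z.arg := lt_of_le_of_ne hznn fun h => hz.ne' (arg_eq_zero_iff.1 h.symm).2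
      linarith), 0, ?_⟩
    refine Asymptotics.IsBigO.of_bound (Real.exp Real.pi) ?_
    filter_upwards [mem_inf_of_right (mem_principal_self _)] with w hw
    simpa using hbd w hw.1.le hw.2.le
  · intro w hw
    have hb0 : 0 ≤ b := hznn.trans hzb
    rw [hnorm, (hstrip w hw.ge (hw.le.trans hb0)).2.2.2 hw, hw, sub_zero, Real.exp_le_exp]
    exact hε.le
  · intro w hw
    rw [hnorm, Real.exp_le_exp, hw]
    linarith [arg_le_pi (f (exp w))]

lemma im_mul_conj_nonpos_of_arg_le {w z : ℂ} (hw : 0 < w.im)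
    (h : w.arg ≤ z.arg) : (w * conj z).im ≤ 0 := by
  have e : (w * conj z).im = ‖w‖ * ‖z‖ * Real.sin (w.arg - z.arg) := by
    rw [Real.sin_sub]
    have h1 := norm_mul_cos_arg w
    have h2 := norm_mul_sin_arg w
    have h3 := norm_mul_cos_arg z
    have h4 := norm_mul_sin_arg z
    simp only [mul_im, conj_re, conj_im]
    rw [← h1, ← h2, ← h3, ← h4]; ring
  rw [e]
  refine mul_nonpos_of_nonneg_of_nonpos (by positivity)
    (Real.sin_nonpos_of_nonpos_of_neg_pi_le (by linarith) ?_)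
  linarith [arg_nonneg_iff.2 hw.le, arg_le_pi z]

lemma im_mul_conj_nonpos_of_im_pos {f : ℂ → ℂ} (hf : DifferentiableOn ℂ f slitPlane)
    (him : ∀ z : ℂ, 0 < z.im → 0 ≤ (f z).im)
    (hpos : ∀ x : ℝ, 0 < x → 0 ≤ f x)
    {z : ℂ} (hz : 0 < z.im) : (f z * conj z).im ≤ 0 := by
  have h := arg_apply_le_arg (fun z => f z + z) (hf.add differentiableOn_id)
    (fun w hw => by have := him w hw; simp only [add_im]; linarith)
    (fun x hx => by
      obtain ⟨h1, h2⟩ := nonneg_iff.1 (hpos x hx)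
      simp only [add_im, add_re, ofReal_im, ofReal_re]
      exact ⟨by linarith, by linarith⟩) hz
  have := im_mul_conj_nonpos_of_arg_le
    (show 0 < (f z + z).im by have := him z hz; simp only [add_im]; linarith) h
  rw [add_mul, add_im, mul_conj, ofReal_im, add_zero] at this
  exact this

/-- If `f` is a scalar complete Bernstein function, then `f z / z` has imaginary part of the
sign opposite to that of `z`. -/
lemma im_mul_im_mul_conj_nonpos {f : ℂ → ℂ} (hf : DifferentiableOn ℂ f slitPlane)
    (him : ∀ z ∈ slitPlane, 0 ≤ z.im * (f z).im)
    (hpos : ∀ x : ℝ, 0 < x → 0 ≤ f x) (z : ℂ) : z.im * (f z * conj z).im ≤ 0 := by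
  rcases lt_trichotomy z.im 0 with h | h | h
  · refine mul_nonpos_of_nonpos_of_nonneg h.le ?_
    have := im_mul_conj_nonpos_of_im_pos (f := conj ∘ f ∘ conj) (z := conj z) ?_ ?_ ?_ (by simpa)
    · simp only [Function.comp, conj_conj, mul_im, conj_re, conj_im] at this ⊢
      linarith
    · intro w hw
      have hw' : conj w ∈ slitPlane := by
        simpa [mem_slitPlane_iff] using hw
      have := (hf.differentiableAt (isOpen_slitPlane.mem_nhds hw')).conj_conj
      rw [conj_conj] at this
      exact this.differentiableWithinAt
    · intro w hw
      have := him (conj w) (Or.inr (by simpa using hw.ne'))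
      simp only [Function.comp, conj_im] at this ⊢
      nlinarith
    · intro x hx
      have h1 := nonneg_iff.1 (hpos x hx)
      simp only [Function.comp, conj_ofReal]
      rw [nonneg_iff]
      simpa using ⟨h1.1, h1.2.symm⟩
  · simp [h]
  · refine mul_nonpos_of_nonneg_of_nonpos h.le (im_mul_conj_nonpos_of_im_pos hf ?_ hpos h)
    intro w hw
    exact nonneg_of_mul_nonneg_right (him w (Or.inr hw.ne')) hw

lemma continuous_inverse_add_smul_one {A : Type*} [NormedRing A] [NormedAlgebra ℂ A]
    [CompleteSpace A] {c s : ℝ → ℂ} (hc : Continuous c) (hs : Continuous s) {x : A}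
    (hunit : ∀ t, IsUnit (c t • x + s t • (1 : A))) :
    Continuous fun t => Ring.inverse (c t • x + s t • (1 : A)) := by
  refine continuous_iff_continuousAt.2 fun t => ?_
  obtain ⟨u, hu⟩ := hunit t
  have h := NormedRing.inverse_continuousAt u
  rw [hu] at h
  exact ContinuousAt.comp (f := fun t => c t • x + s t • (1 : A)) h
    ((hc.smul continuous_const).add (hs.smul continuous_const)).continuousAt

/-- Parametric integral of the inverses of the convex combinations of `F z` and `1`. -/
lemma differentiableOn_integral_inverse {A : Type*} [NormedRing A] [NormedAlgebra ℂ A]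
    [CompleteSpace A] {U : Set ℂ} (hU : IsOpen U) {F : ℂ → A} (hF : DifferentiableOn ℂ F U)
    {c s : ℝ → ℂ} (hc : Continuous c) (hs : Continuous s) {a b : ℝ}
    (hunit : ∀ z ∈ U, ∀ t, IsUnit (c t • F z + s t • (1 : A))) :
    DifferentiableOn ℂ (fun z => ∫ t in a..b, Ring.inverse (c t • F z + s t • (1 : A))) U := by
  set G : ℂ → ℝ → A := fun z t => Ring.inverse (c t • F z + s t • (1 : A)) with hG
  set G' : ℂ → ℝ → A := fun z t => -(G z t * (c t • deriv F z) * G z t) with hG'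
  have hUn : IsOpen (U ×ˢ (Set.univ : Set ℝ)) := hU.prod isOpen_univ
  have hFc : ContinuousOn (fun p : ℂ × ℝ => F p.1) (U ×ˢ Set.univ) :=
    hF.continuousOn.comp continuousOn_fst fun p hp => hp.1
  have hF'c : ContinuousOn (fun p : ℂ × ℝ => deriv F p.1) (U ×ˢ Set.univ) :=
    (hF.deriv hU).continuousOn.comp continuousOn_fst fun p hp => hp.1
  have hGc : ContinuousOn (fun p : ℂ × ℝ => G p.1 p.2) (U ×ˢ Set.univ) := by
    intro p hp
    obtain ⟨u, hu⟩ := hunit p.1 hp.1 p.2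
    have h1 : ContinuousWithinAt (fun p : ℂ × ℝ => c p.2 • F p.1 + s p.2 • (1 : A))
        (U ×ˢ Set.univ) p :=
      ((hc.comp continuous_snd).continuousWithinAt.smul (hFc p hp)).add
        (((hs.comp continuous_snd).smul continuous_const).continuousWithinAt)
    have h2 := NormedRing.inverse_continuousAt u
    rw [hu] at h2
    exact ContinuousAt.comp_continuousWithinAt
      (f := fun p : ℂ × ℝ => c p.2 • F p.1 + s p.2 • (1 : A)) h2 h1
  have hG'c : ContinuousOn (fun p : ℂ × ℝ => G' p.1 p.2) (U ×ˢ Set.univ) :=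
    ((hGc.mul ((hc.comp continuous_snd).continuousOn.smul hF'c)).mul hGc).neg
  have hslice : ∀ z ∈ U, Continuous fun t => G z t := fun z hz =>
    continuous_inverse_add_smul_one hc hs (hunit z hz)
  have hslice' : ∀ z ∈ U, Continuous fun t => G' z t := fun z hz =>
    hG'c.comp_continuous (f := fun t : ℝ => (z, t)) (by fun_prop) fun t => ⟨hz, trivial⟩
  intro z hz
  obtain ⟨r, hr, hrU⟩ := Metric.nhds_basis_closedBall.mem_iff.1 (hU.mem_nhds hz)
  obtain ⟨B, hB⟩ :=
    ((isCompact_closedBall z r).prod (isCompact_uIcc (a := a) (b := b))).exists_bound_of_continuousOn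
    (hG'c.mono (Set.prod_mono hrU (Set.subset_univ _)))
  have := intervalIntegral.hasDerivAt_integral_of_dominated_loc_of_deriv_le (μ := volume)
    (F := G) (F' := G') (x₀ := z) (a := a) (b := b) (bound := fun _ => B)
    (Metric.closedBall_mem_nhds z hr) ?_ ((hslice z hz).intervalIntegrable _ _)
    (hslice' z hz).aestronglyMeasurable ?_ intervalIntegrable_const ?_
  · exact this.2.differentiableAt.differentiableWithinAt
  · filter_upwards [hU.mem_nhds hz] with w hw
    exact (hslice w hw).aestronglyMeasurable
  · exact ae_of_all _ fun t ht w hw => hB (w, t) ⟨hw, Set.uIoc_subset_uIcc ht⟩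
  · refine ae_of_all _ fun t _ w hw => ?_
    obtain ⟨u, hu⟩ := hunit w (hrU hw) t
    have h1 : HasDerivAt (fun w => c t • F w + s t • (1 : A)) (c t • deriv F w) w :=
      ((hF.differentiableAt (hU.mem_nhds (hrU hw))).hasDerivAt.const_smul (c t)).add_const _
    have h2 := hasFDerivAt_ringInverse (𝕜 := ℂ) u
    have h3 : (↑u⁻¹ : A) = G w t := by simp only [hG, ← hu, Ring.inverse_unit]
    rw [hu] at h2
    have h4 := h2.comp_hasDerivAt w h1
    simpa [hG', h3] using! h4

/-- The arctangent form of the antiderivative avoids the pole of the tangent at `π / 2`. -/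
lemma integral_inv_cos_sq_add_sin_sq {m : ℝ} (hm : 0 < m) :
    ∫ t in (0 : ℝ)..(Real.pi / 2), (Real.cos t ^ 2 * m ^ 2 + Real.sin t ^ 2)⁻¹
      = Real.pi / 2 * m⁻¹ := by
  have hden : ∀ (k : ℝ), 0 < k → ∀ t, 0 < k * Real.cos t ^ 2 + Real.sin t ^ 2 := by
    intro k hk t
    rcases eq_or_ne (Real.sin t) 0 with h | h
    · have := Real.sin_sq_add_cos_sq t
      rw [h] at this ⊢
      nlinarith
    · positivity
  have hder : ∀ t ∈ Set.uIcc (0 : ℝ) (Real.pi / 2), HasDerivAt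
      (fun t => m⁻¹ * (t + Real.arctan ((1 - m) * (Real.sin t * Real.cos t) /
        (m * Real.cos t ^ 2 + Real.sin t ^ 2))))
      ((Real.cos t ^ 2 * m ^ 2 + Real.sin t ^ 2)⁻¹) t := by
    intro t _
    have h1 := hden m hm t
    have h2 := hden (m ^ 2) (by positivity) t
    have hs := Real.hasDerivAt_sin t
    have hc := Real.hasDerivAt_cos t
    have hd : HasDerivAt (fun t => m⁻¹ * (t + Real.arctan ((1 - m) * (Real.sin t * Real.cos t) /
        (m * Real.cos t ^ 2 + Real.sin t ^ 2)))) _ t :=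
      (((hasDerivAt_id t).add
        ((((hs.mul hc).const_mul (1 - m)).div
          (((hc.pow 2).const_mul m).add (hs.pow 2)) h1.ne').arctan)).const_mul m⁻¹)
    refine hd.congr_deriv ?_
    simp only [Pi.mul_apply, Pi.add_apply, Pi.pow_apply, Pi.div_apply]
    have h := Real.sin_sq_add_cos_sq t
    generalize Real.sin t = u at *
    generalize Real.cos t = v at *
    have h5 : 1 + ((1 - m) * (u * v) / (m * v ^ 2 + u ^ 2)) ^ 2 =
        (m ^ 2 * v ^ 2 + u ^ 2) / (m * v ^ 2 + u ^ 2) ^ 2 := by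
      rw [eq_div_iff (by positivity), div_pow, add_mul, div_mul_cancel₀ _ (by positivity)]
      linear_combination (m ^ 2 * v ^ 2 + u ^ 2) * h
    have h6 : (1 - m) * (v * v + u * -u) * (m * v ^ 2 + u ^ 2) -
        (1 - m) * (u * v) * (m * ((2 : ℕ) * v ^ (2 - 1) * -u) + (2 : ℕ) * u ^ (2 - 1) * v) =
        (1 - m) * (m * v ^ 2 - u ^ 2) := by
      push_cast
      linear_combination (1 - m) * (m * v ^ 2 - u ^ 2) * h
    rw [h5, h6, mul_comm (v ^ 2)]
    field_simp
    linear_combination m * h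
  rw [intervalIntegral.integral_eq_sub_of_hasDerivAt hder]
  · simp; ring
  · refine Continuous.intervalIntegrable ?_ _ _
    refine Continuous.inv₀ (by fun_prop) fun t => ?_
    have := hden (m ^ 2) (by positivity) t
    rw [mul_comm (Real.cos t ^ 2)]; exact this.ne'

namespace Matrix

variable {n : Type*} [Fintype n] [DecidableEq n]

lemma im_mul_dotProduct_inv_mulVec {G : Matrix n n ℂ} (hG : IsUnit G) (z : ℂ) (x : n → ℂ) :
    (z * (star x ⬝ᵥ G⁻¹ *ᵥ x)).im
      = -((star (G⁻¹ *ᵥ x) ⬝ᵥ G *ᵥ (G⁻¹ *ᵥ x)) * conj z).im := by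
  have hdet := (Matrix.isUnit_iff_isUnit_det _).1 hG
  have hx : G *ᵥ (G⁻¹ *ᵥ x) = x := by
    rw [mulVec_mulVec, mul_nonsing_inv _ hdet, one_mulVec]
  rw [hx, ← conj_im, map_mul, conj_conj, mul_comm z]
  congr 2
  change _ = star (star (G⁻¹ *ᵥ x) ⬝ᵥ x)
  exact star_dotProduct _ _

/-- A square root of a positive definite matrix with spectrum in the open right half-plane is
unitarily diagonalizable with positive eigenvalues. -/
lemma exists_unitary_diagonal_of_mul_self_posDef {A : Matrix n n ℂ} (hA : (A * A).PosDef)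
    (hspec : ∀ c ∈ spectrum ℂ A, 0 < c.re) :
    ∃ (U : Matrix n n ℂ) (m : n → ℝ), (∀ j, 0 < m j) ∧ U * star U = 1 ∧ star U * U = 1 ∧
      A = U * diagonal (fun j => (m j : ℂ)) * star U := by
  have hH := hA.isHermitian
  set U : Matrix n n ℂ := (hH.eigenvectorUnitary : Matrix n n ℂ) with hU
  have hU1 : U * star U = 1 := Unitary.coe_mul_star_self _
  have hU2 : star U * U = 1 := Unitary.coe_star_mul_self _
  refine ⟨U, fun j => √(hH.eigenvalues j), fun j => Real.sqrt_pos.2 (hA.eigenvalues_pos j),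
    hU1, hU2, ?_⟩
  have key : A * U = U * diagonal (fun j => ((√(hH.eigenvalues j) : ℝ) : ℂ)) := by
    ext i j
    rw [mul_diagonal]
    set v : n → ℂ := ⇑(hH.eigenvectorBasis j) with hv
    set m : ℂ := ((√(hH.eigenvalues j) : ℝ) : ℂ) with hm
    have hm2 : m * m = (hH.eigenvalues j : ℂ) := by
      rw [hm, ← ofReal_mul, Real.mul_self_sqrt (hA.eigenvalues_pos j).le]
    have hunit : IsUnit (A + m • (1 : Matrix n n ℂ)) := by
      have : -m ∉ spectrum ℂ A := fun h => by
        have h1 := hspec _ h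
        rw [hm, neg_re, ofReal_re] at h1
        linarith [Real.sqrt_nonneg (hH.eigenvalues j)]
      rw [spectrum.notMem_iff] at this
      convert this.neg using 1
      rw [Algebra.algebraMap_eq_smul_one, neg_smul]
      abel
    have hAv : (A * A) *ᵥ v = (m * m) • v := by
      rw [hv, hH.mulVec_eigenvectorBasis, hm2]
      ext; simp
    have hzero : (A + m • (1 : Matrix n n ℂ)) *ᵥ (A *ᵥ v - m • v) = 0 := by
      rw [mulVec_sub, add_mulVec, add_mulVec, mulVec_mulVec, hAv, smul_mulVec, smul_mulVec,
        one_mulVec, one_mulVec, mulVec_smul, smul_smul]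
      abel
    have hz := (mulVec_injective_iff_isUnit.2 hunit) (hzero.trans (mulVec_zero _).symm)
    have := congrFun (sub_eq_zero.1 hz) i
    simp only [Pi.smul_apply, smul_eq_mul] at this
    rw [mul_comm]
    exact this
  rw [← key, mul_assoc, hU1, mul_one]

lemma inv_unitary_conj_diagonal {U : Matrix n n ℂ} (hU1 : U * star U = 1) (hU2 : star U * U = 1)
    {e : n → ℂ} (he : ∀ j, e j ≠ 0) :
    (U * diagonal e * star U)⁻¹ = U * diagonal (fun j => (e j)⁻¹) * star U := by
  apply inv_eq_right_inv
  calc U * diagonal e * star U * (U * diagonal (fun j => (e j)⁻¹) * star U)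
      = U * diagonal e * (star U * U) * diagonal (fun j => (e j)⁻¹) * star U := by
        simp only [mul_assoc]
    _ = 1 := by
        rw [hU2, mul_one, mul_assoc U, diagonal_mul_diagonal]
        simp [he, hU1]

lemma unitary_conj_diagonal_apply (U : Matrix n n ℂ) (e : n → ℂ) (i j : n) :
    (U * diagonal e * star U) i j = ∑ k, U i k * e k * conj (U j k) := by
  rw [mul_apply]
  simp only [mul_diagonal, star_apply]
  rfl

lemma inv_apply_eq_integral {A : Matrix n n ℂ} (hA : (A * A).PosDef)
    (hspec : ∀ c ∈ spectrum ℂ A, 0 < c.re) (i j : n) :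
    A⁻¹ i j = (2 / Real.pi : ℂ) * ∫ t in (0 : ℝ)..(Real.pi / 2),
      ((((Real.cos t ^ 2 : ℝ) : ℂ) • (A * A) + ((Real.sin t ^ 2 : ℝ) : ℂ) • 1)⁻¹ :
        Matrix n n ℂ) i j := by
  obtain ⟨U, m, hm, hU1, hU2, rfl⟩ := exists_unitary_diagonal_of_mul_self_posDef hA hspec
  have hden : ∀ t k, 0 < Real.cos t ^ 2 * m k ^ 2 + Real.sin t ^ 2 := by
    intro t k
    rcases eq_or_ne (Real.sin t) 0 with h | h
    · have := Real.sin_sq_add_cos_sq t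
      have := pow_pos (hm k) 2
      rw [h] at *
      nlinarith
    · positivity
  have hG : ∀ t : ℝ, (((Real.cos t ^ 2 : ℝ) : ℂ) •
      ((U * diagonal (fun j => (m j : ℂ)) * star U) * (U * diagonal (fun j => (m j : ℂ)) * star U))
        + ((Real.sin t ^ 2 : ℝ) : ℂ) • (1 : Matrix n n ℂ))
      = U * diagonal (fun k => ((Real.cos t ^ 2 * m k ^ 2 + Real.sin t ^ 2 : ℝ) : ℂ)) * star U := by
    intro t
    have h1 : (U * diagonal (fun j => (m j : ℂ)) * star U) *
        (U * diagonal (fun j => (m j : ℂ)) * star U)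
        = U * diagonal (fun k => (m k : ℂ) ^ 2) * star U := by
      calc _ = U * diagonal (fun j => (m j : ℂ)) * (star U * U) * diagonal (fun j => (m j : ℂ))
            * star U := by simp only [mul_assoc]
        _ = _ := by
          rw [hU2, mul_one, mul_assoc U, diagonal_mul_diagonal]
          simp only [sq]
    have h2 : (1 : Matrix n n ℂ) = U * diagonal (fun _ => (1 : ℂ)) * star U := by
      rw [diagonal_one, mul_one, hU1]
    rw [h1]
    nth_rw 1 [h2]
    ext a b
    simp only [add_apply, smul_apply, unitary_conj_diagonal_apply, smul_eq_mul, Finset.mul_sum,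
      ← Finset.sum_add_distrib]
    refine Finset.sum_congr rfl fun k _ => ?_
    push_cast
    ring
  have hI : ∀ k, ∫ t in (0 : ℝ)..(Real.pi / 2),
      ((Real.cos t ^ 2 * m k ^ 2 + Real.sin t ^ 2 : ℝ) : ℂ)⁻¹ = Real.pi / 2 * (m k : ℂ)⁻¹ := by
    intro k
    have := congrArg ((↑) : ℝ → ℂ) (integral_inv_cos_sq_add_sin_sq (hm k))
    rw [← intervalIntegral.integral_ofReal] at this
    push_cast at this ⊢
    exact this
  simp only [hG]
  rw [inv_unitary_conj_diagonal hU1 hU2 fun k => ofReal_ne_zero.2 (hm k).ne']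
  simp only [fun t => inv_unitary_conj_diagonal hU1 hU2 fun k => ofReal_ne_zero.2 (hden t k).ne',
    unitary_conj_diagonal_apply]
  rw [intervalIntegral.integral_finsetSum, Finset.mul_sum]
  · refine Finset.sum_congr rfl fun k _ => ?_
    rw [intervalIntegral.integral_mul_const, intervalIntegral.integral_const_mul, hI]
    have := ofReal_ne_zero.2 Real.pi_ne_zero
    field_simp
  · intro k _
    refine Continuous.intervalIntegrable ?_ _ _
    refine (continuous_const.mul (Continuous.inv₀ (by fun_prop) fun t => ?_)).mul continuous_const
    exact ofReal_ne_zero.2 (hden t k).ne'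

lemma posSemidef_ofReal_smul_imP_iff {d : ℕ} (t : ℝ) (X : Matrix (Fin d) (Fin d) ℂ) :
    ((t : ℂ) • X.imP).PosSemidef ↔ ∀ x, 0 ≤ t * (star x ⬝ᵥ X *ᵥ x).im := by
  have hform : ∀ x, star x ⬝ᵥ ((t : ℂ) • X.imP) *ᵥ x
      = ((t * (star x ⬝ᵥ X *ᵥ x).im : ℝ) : ℂ) := by
    intro x
    have h1 : star x ⬝ᵥ Xᴴ *ᵥ x = conj (star x ⬝ᵥ X *ᵥ x) := by
      change _ = star (star x ⬝ᵥ X *ᵥ x)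
      rw [← star_dotProduct, star_mulVec, dotProduct_mulVec]
    rw [imP, smul_mulVec, smul_mulVec, sub_mulVec, dotProduct_smul, dotProduct_smul,
      dotProduct_sub, h1, sub_conj, smul_eq_mul, smul_eq_mul]
    push_cast
    field_simp
  have hherm : ((t : ℂ) • X.imP).IsHermitian := by
    rw [IsHermitian, imP, conjTranspose_smul, conjTranspose_smul, conjTranspose_sub,
      conjTranspose_conjTranspose, ← neg_sub X, smul_neg, ← neg_smul]
    congr 2
    · exact conj_ofReal t
    · simp
  rw [posSemidef_iff_dotProduct_mulVec]
  simp only [hform, zero_le_real]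
  exact and_iff_right hherm

open scoped MatrixOrder in
lemma PosSemidef.map_ofReal {M : Matrix n n ℝ} (hM : M.PosSemidef) :
    (M.map (fun t => (t : ℂ))).PosSemidef := by
  obtain ⟨B, rfl⟩ := CStarAlgebra.nonneg_iff_eq_star_mul_self.mp hM.nonneg
  have h : (star B * B).map (fun t => (t : ℂ))
      = (B.map (fun t => (t : ℂ)))ᴴ * B.map (fun t => (t : ℂ)) := by
    ext i j
    simp [mul_apply, star_apply]
  rw [h]
  exact posSemidef_conjTranspose_mul_self _

omit [DecidableEq n] in
lemma map_ofReal_mul (A B : Matrix n n ℝ) : (A * B).map (fun t => (t : ℂ))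
    = A.map (fun t => (t : ℂ)) * B.map (fun t => (t : ℂ)) :=
  Matrix.map_mul (f := ofRealHom)

omit [Fintype n] in
lemma map_ofReal_one : (1 : Matrix n n ℝ).map (fun t => (t : ℂ)) = 1 :=
  Matrix.map_one _ ofReal_zero ofReal_one

lemma PosDef.map_ofReal {M : Matrix n n ℝ} (hM : M.PosDef) :
    (M.map (fun t => (t : ℂ))).PosDef := by
  rw [hM.posSemidef.map_ofReal.posDef_iff_isUnit]
  exact hM.isUnit.map (ofRealHom.mapMatrix (m := n))

lemma map_ofReal_inv {A : Matrix n n ℝ} (hA : IsUnit A) :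
    (A.map (fun t => (t : ℂ)))⁻¹ = A⁻¹.map (fun t => (t : ℂ)) := by
  apply inv_eq_right_inv
  rw [← map_ofReal_mul, mul_nonsing_inv _ ((isUnit_iff_isUnit_det _).1 hA), map_ofReal_one]

lemma isUnit_convexComb_one {M : Matrix n n ℂ} (hM : ∀ c ∈ spectrum ℂ M, c ∈ slitPlane) (t : ℝ) :
    IsUnit (((Real.cos t ^ 2 : ℝ) : ℂ) • M + ((Real.sin t ^ 2 : ℝ) : ℂ) • (1 : Matrix n n ℂ)) := by
  rcases eq_or_ne (Real.cos t) 0 with h | h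
  · have h2 : Real.sin t ^ 2 = 1 := by have := Real.sin_sq_add_cos_sq t; rw [h] at this; linarith
    simp [h, h2]
  · have hc : ((Real.cos t ^ 2 : ℝ) : ℂ) ≠ 0 := ofReal_ne_zero.2 (pow_ne_zero 2 h)
    have hmem : (((-(Real.sin t ^ 2 / Real.cos t ^ 2) : ℝ)) : ℂ) ∉ spectrum ℂ M := fun hs => by
      have := ofReal_mem_slitPlane.1 (hM _ hs)
      have : 0 ≤ Real.sin t ^ 2 / Real.cos t ^ 2 := by positivity
      linarith
    rw [spectrum.notMem_iff] at hmem
    have := (hmem.neg).smul (Units.mk0 _ hc)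
    convert this using 1
    rw [Units.smul_def, Units.val_mk0, neg_sub, smul_sub, Algebra.algebraMap_eq_smul_one,
      smul_smul, sub_eq_add_neg, ← neg_smul]
    congr 2
    rw [← ofReal_mul, ← ofReal_neg]
    congr 1
    field_simp

lemma continuous_inv_apply {G : ℝ → Matrix n n ℂ} (hG : Continuous G) (hu : ∀ t, IsUnit (G t))
    (i j : n) : Continuous fun t => (G t)⁻¹ i j := by
  refine Continuous.matrix_elem (A := fun t => (G t)⁻¹) ?_ i j
  refine continuous_iff_continuousAt.2 fun t => ?_
  refine ContinuousAt.comp (f := G) (g := Inv.inv) (continuousAt_matrix_inv _ ?_) hG.continuousAt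
  rw [Ring.inverse_eq_inv']
  exact continuousAt_inv₀ ((isUnit_iff_isUnit_det _).1 (hu t)).ne_zero

attribute [local instance] Matrix.linftyOpNormedRing Matrix.linftyOpNormedAlgebra in
lemma differentiableOn_integral_inv_apply {U : Set ℂ} (hU : IsOpen U) {F : ℂ → Matrix n n ℂ}
    (hF : ∀ i j, DifferentiableOn ℂ (fun z => F z i j) U) {c s : ℝ → ℂ} (hc : Continuous c)
    (hs : Continuous s) {a b : ℝ}
    (hunit : ∀ z ∈ U, ∀ t, IsUnit (c t • F z + s t • (1 : Matrix n n ℂ))) (i j : n) :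
    DifferentiableOn ℂ
      (fun z => ∫ t in a..b, (c t • F z + s t • (1 : Matrix n n ℂ))⁻¹ i j) U := by
  have hF' : DifferentiableOn ℂ F U := by
    have : F = fun z => ∑ i, ∑ j, F z i j • single i j (1 : ℂ) := by
      ext z : 1
      conv_lhs => rw [matrix_eq_sum_single (F z)]
      simp
    rw [this]
    exact DifferentiableOn.fun_sum fun i _ => DifferentiableOn.fun_sum fun j _ =>
      (hF i j).smul_const _
  let φ : Matrix n n ℂ →L[ℂ] ℂ := LinearMap.toContinuousLinearMap (entryLinearMap ℂ ℂ i j)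
  refine (φ.differentiable.comp_differentiableOn
    (differentiableOn_integral_inverse hU hF' hc hs hunit (a := a) (b := b))).congr fun z hz => ?_
  refine Eq.trans ?_ (φ.intervalIntegral_comp_comm
    ((continuous_inverse_add_smul_one hc hs (hunit z hz)).intervalIntegrable _ _))
  simp only [nonsing_inv_eq_ringInverse]
  rfl

end Matrix

/-- The quadratic form of a matrix-valued complete Bernstein function with positive semidefinite
values satisfies the scalar sign condition. -/
lemma IsMvCBFWith.im_mul_im_dotProduct_mulVec_mul_conj_nonpos {d : ℕ}
    {Q : ℝ → Matrix (Fin d) (Fin d) ℝ} {F : ℂ → Matrix (Fin d) (Fin d) ℂ} (hQF : IsMvCBFWith Q F)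
    (hQ : ∀ x : ℝ, 0 < x → (Q x).PosSemidef) (v : Fin d → ℂ) (z : ℂ) :
    z.im * ((star v ⬝ᵥ F z *ᵥ v) * conj z).im ≤ 0 := by
  refine im_mul_im_mul_conj_nonpos (f := fun z => star v ⬝ᵥ F z *ᵥ v) ?_ ?_ ?_ z
  · simp only [dotProduct, Matrix.mulVec]
    exact DifferentiableOn.fun_sum fun i _ => (DifferentiableOn.fun_sum fun j _ =>
      (hQF.1 i j).mul_const _).const_mul _
  · exact fun w hw => (Matrix.posSemidef_ofReal_smul_imP_iff _ _).1 (hQF.2.2.1 w hw) v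
  · intro x hx
    rw [hQF.2.1 x hx]
    exact (hQ x hx).map_ofReal.dotProduct_mulVec_nonneg v

namespace Matrix

variable {n : Type*} [Fintype n] [DecidableEq n]

/-- A real square root of a positive definite real matrix with spectrum in the open right
half-plane is symmetric. -/
lemma isSymm_of_mul_self_posDef {R : Matrix n n ℝ} (hR : (R * R).PosDef)
    (hspec : ∀ c ∈ spectrum ℂ (R.map (fun t => (t : ℂ))), 0 < c.re) : R.IsSymm := by
  have hc := hR.map_ofReal
  rw [map_ofReal_mul] at hc
  obtain ⟨U, m, -, -, -, h⟩ := exists_unitary_diagonal_of_mul_self_posDef hc hspec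
  have hstar : (R.map (fun t => (t : ℂ)))ᴴ = R.map (fun t => (t : ℂ)) := by
    have hd : star (diagonal fun j => (m j : ℂ)) = diagonal fun j => (m j : ℂ) := by
      rw [star_eq_conjTranspose, diagonal_conjTranspose]
      congr 1
      ext j
      exact conj_ofReal _
    rw [h, ← star_eq_conjTranspose, star_mul, star_mul, star_star, hd, mul_assoc]
  ext i j
  have := congrFun (congrFun hstar i) j
  simpa using this

lemma inv_apply_sq_le {R : Matrix n n ℝ} (hR : R.IsSymm) (i j : n) :
    (R⁻¹ i j) ^ 2 ≤ (R * R)⁻¹ i i := by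
  have hs : ∀ k, R⁻¹ k i = R⁻¹ i k := fun k => by
    conv_rhs => rw [← hR.eq, ← transpose_nonsing_inv, transpose_apply]
  rw [mul_inv_rev, mul_apply]
  simp only [hs, ← sq]
  exact Finset.single_le_sum (f := fun k => (R⁻¹ i k) ^ 2) (fun k _ => sq_nonneg _)
    (Finset.mem_univ j)

omit [DecidableEq n] in
lemma posSemidef_of_tendsto {ι : Type*} {l : Filter ι} [l.NeBot] {M : ι → Matrix n n ℝ}
    {L : Matrix n n ℝ} (h : Tendsto M l (𝓝 L)) (hM : ∀ᶠ x in l, (M x).PosSemidef) :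
    L.PosSemidef := by
  refine PosSemidef.of_dotProduct_mulVec_nonneg ?_ fun v => ?_
  · have h1 : Tendsto (fun x => (M x)ᴴ) l (𝓝 Lᴴ) :=
      (continuous_id.matrix_conjTranspose.tendsto L).comp h
    refine tendsto_nhds_unique (h1.congr' ?_) h
    filter_upwards [hM] with x hx using hx.1
  · have h1 : Tendsto (fun x => star v ⬝ᵥ M x *ᵥ v) l (𝓝 (star v ⬝ᵥ L *ᵥ v)) :=
      ((continuous_const.dotProduct (continuous_id.matrix_mulVec continuous_const)).tendsto L).comp
        h
    exact ge_of_tendsto h1 (hM.mono fun x hx => hx.dotProduct_mulVec_nonneg v)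

lemma tendsto_smul_inv_zero {Q R : ℝ → Matrix n n ℝ} {G L : Matrix n n ℝ}
    (hQ : Tendsto Q (𝓝[>] 0) (𝓝 L)) (hG : G.PosDef)
    (hQG : ∀ x, 0 < x → (Q x - G).PosSemidef) (hR : ∀ x, 0 < x → (R x).IsSymm)
    (hsq : ∀ x, 0 < x → R x * R x = Q x) (ρ : ℝ) :
    Tendsto (fun x => (ρ * x) • (R x)⁻¹) (𝓝[>] 0) (𝓝 0) := by
  have hLG : (L - G).PosSemidef := posSemidef_of_tendsto (hQ.sub_const G)
    (by filter_upwards [self_mem_nhdsWithin] with x hx using hQG x hx)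
  have hL : L.PosDef := by simpa using hG.add_posSemidef hLG
  have hinv : Tendsto (fun x => (Q x)⁻¹) (𝓝[>] 0) (𝓝 L⁻¹) := by
    refine (continuousAt_matrix_inv L ?_).tendsto.comp hQ
    rw [Ring.inverse_eq_inv']
    exact continuousAt_inv₀ hL.det_pos.ne'
  have hx0 : Tendsto (fun x : ℝ => (ρ * x) ^ 2) (𝓝[>] 0) (𝓝 0) := by
    have : Tendsto (fun x : ℝ => (ρ * x) ^ 2) (𝓝 0) (𝓝 ((ρ * 0) ^ 2)) :=
      Continuous.tendsto (by fun_prop) 0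
    simpa using this.mono_left nhdsWithin_le_nhds
  refine tendsto_pi_nhds.2 fun i => tendsto_pi_nhds.2 fun j => ?_
  have hii : Tendsto (fun x => (Q x)⁻¹ i i) (𝓝[>] 0) (𝓝 (L⁻¹ i i)) :=
    ((continuous_id.matrix_elem i i).tendsto L⁻¹).comp hinv
  have hbound : Tendsto (fun x => (ρ * x) ^ 2 * (Q x)⁻¹ i i) (𝓝[>] 0) (𝓝 0) := by
    simpa using hx0.mul hii
  have hsqz : Tendsto (fun x => (((ρ * x) • (R x)⁻¹) i j) ^ 2) (𝓝[>] 0) (𝓝 0) := by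
    refine tendsto_of_tendsto_of_tendsto_of_le_of_le' tendsto_const_nhds hbound
      (Eventually.of_forall fun x => sq_nonneg _) ?_
    filter_upwards [self_mem_nhdsWithin] with x hx
    rw [smul_apply, smul_eq_mul, mul_pow, ← hsq x hx]
    exact mul_le_mul_of_nonneg_left (inv_apply_sq_le (hR x hx) i j) (sq_nonneg _)
  have := (Real.continuous_sqrt.tendsto 0).comp hsqz
  simp only [Function.comp_def, Real.sqrt_sq_eq_abs, Real.sqrt_zero] at this
  exact (tendsto_zero_iff_abs_tendsto_zero _).2 this

end Matrix

/-- The convex combination of `M` and the identity whose inverse averages, over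
`0 ≤ t ≤ π / 2`, to the inverse principal square root of `M`. -/
def sqrtPencil {d : ℕ} (M : Matrix (Fin d) (Fin d) ℂ) (t : ℝ) : Matrix (Fin d) (Fin d) ℂ :=
  ((Real.cos t ^ 2 : ℝ) : ℂ) • M + ((Real.sin t ^ 2 : ℝ) : ℂ) • 1

/-- The analytic continuation of `p ↦ ρ p Q(p)^{-1/2}`. -/
def kExtension {d : ℕ} (ρ : ℝ) (F : ℂ → Matrix (Fin d) (Fin d) ℂ) (z : ℂ) :
    Matrix (Fin d) (Fin d) ℂ :=
  Matrix.of fun i j => ρ * z * ((2 / Real.pi : ℂ) *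
    ∫ t in (0 : ℝ)..(Real.pi / 2), (sqrtPencil (F z) t)⁻¹ i j)

lemma continuous_sqrtPencil {d : ℕ} (M : Matrix (Fin d) (Fin d) ℂ) :
    Continuous (sqrtPencil M) := by
  unfold sqrtPencil
  fun_prop

lemma im_mul_im_sqrtPencil_inv_nonneg {d : ℕ} {M : Matrix (Fin d) (Fin d) ℂ} {z : ℂ}
    (hspec : ∀ c ∈ spectrum ℂ M, c ∈ slitPlane)
    (hM : ∀ v, z.im * ((star v ⬝ᵥ M *ᵥ v) * conj z).im ≤ 0) (x : Fin d → ℂ) (t : ℝ) :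
    0 ≤ z.im * (z * (star x ⬝ᵥ (sqrtPencil M t)⁻¹ *ᵥ x)).im := by
  rw [Matrix.im_mul_dotProduct_inv_mulVec (G := sqrtPencil M t)
    (Matrix.isUnit_convexComb_one hspec t)]
  set y := (sqrtPencil M t)⁻¹ *ᵥ x with hy
  have h1 := hM y
  obtain ⟨h2, h3⟩ := nonneg_iff.1 (dotProduct_star_self_nonneg y)
  have h4 : star y ⬝ᵥ sqrtPencil M t *ᵥ y = ((Real.cos t ^ 2 : ℝ) : ℂ) * (star y ⬝ᵥ M *ᵥ y)
      + ((Real.sin t ^ 2 : ℝ) : ℂ) * (star y ⬝ᵥ y) := by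
    rw [sqrtPencil, Matrix.add_mulVec, Matrix.smul_mulVec, Matrix.smul_mulVec, Matrix.one_mulVec,
      dotProduct_add, dotProduct_smul, dotProduct_smul, smul_eq_mul, smul_eq_mul]
  have h5 : ((star y ⬝ᵥ sqrtPencil M t *ᵥ y) * conj z).im
      = Real.cos t ^ 2 * ((star y ⬝ᵥ M *ᵥ y) * conj z).im
        - Real.sin t ^ 2 * (star y ⬝ᵥ y).re * z.im := by
    rw [h4, add_mul, mul_assoc, mul_assoc, add_im, im_ofReal_mul, im_ofReal_mul,
      mul_im (star y ⬝ᵥ y), ← h3, conj_im]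
    ring
  rw [h5]
  have h6 := mul_nonneg (sq_nonneg (Real.cos t)) (neg_nonneg.2 h1)
  have h7 : 0 ≤ Real.sin t ^ 2 * (star y ⬝ᵥ y).re * z.im ^ 2 :=
    mul_nonneg (mul_nonneg (sq_nonneg _) h2) (sq_nonneg _)
  nlinarith

lemma dotProduct_kExtension_mulVec {d : ℕ} (ρ : ℝ) {F : ℂ → Matrix (Fin d) (Fin d) ℂ} {z : ℂ}
    (hspec : ∀ c ∈ spectrum ℂ (F z), c ∈ slitPlane) (x : Fin d → ℂ) :
    star x ⬝ᵥ kExtension ρ F z *ᵥ x = ((ρ * (2 / Real.pi) : ℝ) : ℂ) *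
      ∫ t in (0 : ℝ)..(Real.pi / 2), z * (star x ⬝ᵥ (sqrtPencil (F z) t)⁻¹ *ᵥ x) := by
  have hcont : ∀ i j, Continuous fun t => (sqrtPencil (F z) t)⁻¹ i j :=
    Matrix.continuous_inv_apply (continuous_sqrtPencil _) (Matrix.isUnit_convexComb_one hspec)
  simp only [dotProduct, Matrix.mulVec, kExtension, Matrix.of_apply]
  rw [intervalIntegral.integral_const_mul, intervalIntegral.integral_finsetSum]
  · simp only [Finset.mul_sum]
    refine Finset.sum_congr rfl fun i _ => ?_
    rw [intervalIntegral.integral_finsetSum]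
    · simp only [Finset.mul_sum]
      refine Finset.sum_congr rfl fun j _ => ?_
      rw [intervalIntegral.integral_const_mul, intervalIntegral.integral_mul_const]
      push_cast
      ring
    · exact fun j _ => (continuous_const.mul ((hcont i j).mul continuous_const)).intervalIntegrable
        _ _
  · exact fun i _ => (continuous_const.mul (continuous_finsetSum _ fun j _ =>
      (hcont i j).mul continuous_const)).intervalIntegrable _ _

lemma im_mul_im_kExtension_nonneg {d : ℕ} {ρ : ℝ} (hρ : 0 ≤ ρ)
    {F : ℂ → Matrix (Fin d) (Fin d) ℂ} {z : ℂ}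
    (hspec : ∀ c ∈ spectrum ℂ (F z), c ∈ slitPlane)
    (hF : ∀ v, z.im * ((star v ⬝ᵥ F z *ᵥ v) * conj z).im ≤ 0) (x : Fin d → ℂ) :
    0 ≤ z.im * (star x ⬝ᵥ kExtension ρ F z *ᵥ x).im := by
  have hcont : Continuous fun t => z * (star x ⬝ᵥ (sqrtPencil (F z) t)⁻¹ *ᵥ x) := by
    have hcont' : ∀ i j, Continuous fun t => (sqrtPencil (F z) t)⁻¹ i j :=
      Matrix.continuous_inv_apply (continuous_sqrtPencil _) (Matrix.isUnit_convexComb_one hspec)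
    simp only [dotProduct, Matrix.mulVec]
    exact continuous_const.mul (continuous_finsetSum _ fun i _ => continuous_const.mul
      (continuous_finsetSum _ fun j _ => (hcont' i j).mul continuous_const))
  rw [dotProduct_kExtension_mulVec ρ hspec, im_ofReal_mul, mul_left_comm,
    ← imCLM_apply (∫ t in _.._, _), ← imCLM.intervalIntegral_comp_comm
    (hcont.intervalIntegrable _ _), ← intervalIntegral.integral_const_mul]
  exact mul_nonneg (by positivity) (intervalIntegral.integral_nonneg (by positivity)
    fun t _ => im_mul_im_sqrtPencil_inv_nonneg hspec hF x t)

/-- let `Q` be a matrix-valued complete Bernstein function with real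
symmetric values, `G∞` a real symmetric positive definite matrix with `Q(x) ≥ G∞`
(Loewner order) for all `x > 0`, such that the analytic continuation `F` of `Q` has no
eigenvalue in `(−∞,0]` anywhere on the cut plane.  Then for every `ρ > 0` the function
`K(p) := ρ·p·Q(p)^{-1/2}` (inverse of the principal square root, formalized via any
`R` with `R(x)² = Q(x)` and complexified spectrum in the open right half-plane) is a
matrix-valued complete Bernstein function. -/
theorem mvCBF_K_function {d : ℕ}
    (Q : ℝ → Matrix (Fin d) (Fin d) ℝ) (F : ℂ → Matrix (Fin d) (Fin d) ℂ)
    (hQF : IsMvCBFWith Q F)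
    (hsym : ∀ x : ℝ, 0 < x → (Q x).IsSymm)
    (Ginf : Matrix (Fin d) (Fin d) ℝ) (hGsym : Ginf.IsSymm) (hGpos : Ginf.PosDef)
    (hLoewner : ∀ x : ℝ, 0 < x → (Q x - Ginf).PosSemidef)
    (hspec : ∀ z ∈ Complex.slitPlane, ∀ c ∈ spectrum ℂ (F z), c ∈ Complex.slitPlane)
    (ρ : ℝ) (hρ : 0 < ρ)
    (R : ℝ → Matrix (Fin d) (Fin d) ℝ)
    (hsq : ∀ x : ℝ, 0 < x → R x * R x = Q x)
    (hhalf : ∀ x : ℝ, 0 < x →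
      ∀ c ∈ spectrum ℂ ((R x).map (fun t => (t : ℂ))), 0 < c.re) :
    IsMvCBF (fun p : ℝ => (ρ * p) • (R p)⁻¹) := by
  have hQpos : ∀ x : ℝ, 0 < x → (Q x).PosDef := fun x hx => by
    simpa using hGpos.add_posSemidef (hLoewner x hx)
  have hRpos : ∀ x : ℝ, 0 < x → (R x * R x).PosDef := fun x hx => by
    rw [hsq x hx]
    exact hQpos x hx
  have hRsymm : ∀ x : ℝ, 0 < x → (R x).IsSymm := fun x hx =>
    Matrix.isSymm_of_mul_self_posDef (hRpos x hx) (hhalf x hx)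
  refine ⟨kExtension ρ F, fun i j => ?_, fun x hx => ?_, fun z hz => ?_, 0, ?_⟩
  · refine DifferentiableOn.mul (by fun_prop) (DifferentiableOn.const_mul ?_ _)
    exact Matrix.differentiableOn_integral_inv_apply isOpen_slitPlane hQF.1
      (c := fun t => ((Real.cos t ^ 2 : ℝ) : ℂ)) (s := fun t => ((Real.sin t ^ 2 : ℝ) : ℂ))
      (by fun_prop) (by fun_prop) (fun z hz t => Matrix.isUnit_convexComb_one (hspec z hz) t) i j
  · have hunit : IsUnit (R x) := isUnit_of_mul_isUnit_left (hRpos x hx).isUnit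
    have hc := (hRpos x hx).map_ofReal
    rw [Matrix.map_ofReal_mul] at hc
    ext i j
    have h := Matrix.inv_apply_eq_integral hc (hhalf x hx) i j
    rw [Matrix.map_ofReal_inv hunit, ← Matrix.map_ofReal_mul, hsq x hx, ← hQF.2.1 x hx] at h
    simp only [kExtension, Matrix.of_apply, sqrtPencil]
    rw [← h]
    simp
  · rw [Matrix.posSemidef_ofReal_smul_imP_iff]
    exact im_mul_im_kExtension_nonneg hρ.le (hspec z hz) fun v =>
      hQF.im_mul_im_dotProduct_mulVec_mul_conj_nonpos (fun x hx => (hQpos x hx).posSemidef) v z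
  · obtain ⟨L, hL⟩ := hQF.2.2.2
    exact Matrix.tendsto_smul_inv_zero hL hGpos hLoewner hRsymm hsq ρ
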